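/- arXiv:1503.08090 — 2 statements merged into one kernel-verified Lean document; each statement's English description precedes it below -/
import Mathlib

section
/- For every real-valued w : P → ℝ and every p ∈ P, F♯(w)(p) ≤ F♭(w)(p) in ℝ̄, where F♯(w)(p) = max(max_{i∈I} F♯_i(w)(p), X^in†(p)) and F♭(w)(p) = max(max_{i∈I} F_i♭(w)(p), X^in♭(p)). -/
open MvPolynomial Filter

noncomputable section

abbrev MvPoly (d : ℕ) := MvPolynomial (Fin d) ℝ

/-- `q` is a sum of squares of polynomials (`q ∈ Σ[x]`). -/
def IsSOS {d : ℕ} (q : MvPoly d) : Prop :=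
  ∃ (n : ℕ) (g : Fin n → MvPoly d), q = ∑ j, g j ^ 2

/-- The map `ℝ^d → ℝ^d` whose components are the polynomials `T j`. -/
def polyMapApply {d : ℕ} (T : Fin d → MvPoly d) (x : Fin d → ℝ) : Fin d → ℝ :=
  fun j => eval x (T j)

/-- Degree of a polynomial map: the maximum total degree of its components. -/
def degMap {d : ℕ} (T : Fin d → MvPoly d) : ℕ :=
  Finset.univ.sup fun j => (T j).totalDegree

/-- `ur : P → ℝ` is the real-valued representative of `u : P → ℝ̄`. -/
def RealRep {ιP : Type} (u : ιP → EReal) (ur : ιP → ℝ) : Prop :=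
  ∀ p, Real.toEReal (ur p) = u p

/-- Context: a constrained piecewise discrete-time polynomial system together with
a finite basis of polynomial templates of degree at most `2m`. -/
structure PPSCtx (d m : ℕ) (I ιP : Type) [Fintype I] [Fintype ιP] where
  nI : I → ℕ
  rI : (i : I) → Fin (nI i) → MvPoly d
  n0 : ℕ
  r0 : Fin n0 → MvPoly d
  nin : ℕ
  rin : Fin nin → MvPoly d
  T : I → Fin d → MvPoly d
  tmpl : ιP → MvPoly d
  htmpl : ∀ p, (tmpl p).totalDegree ≤ 2 * m

namespace PPSCtx

variable {d m : ℕ} {I ιP : Type} [Fintype I] [Fintype ιP] (S : PPSCtx d m I ιP)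

def Xi (i : I) : Set (Fin d → ℝ) := {x | ∀ j, eval x (S.rI i j) ≤ 0}

def X0 : Set (Fin d → ℝ) := {x | ∀ k, eval x (S.r0 k) ≤ 0}

def Xin : Set (Fin d → ℝ) := {x | ∀ j, eval x (S.rin j) ≤ 0}

def wStar (w : ιP → ℝ) : Set (Fin d → ℝ) := {x | ∀ p, eval x (S.tmpl p) ≤ w p}

/-- `F♯_i(w)(p)`. -/
def FsharpI (w : ιP → ℝ) (i : I) (p : ιP) : EReal :=
  ⨆ x ∈ S.wStar w ∩ S.Xi i ∩ S.X0,
    Real.toEReal (eval (polyMapApply (S.T i) x) (S.tmpl p))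

/-- `X^in†(p)`. -/
def XinDag (p : ιP) : EReal :=
  ⨆ x ∈ S.Xin, Real.toEReal (eval x (S.tmpl p))

/-- The SOS certificate constraints witnessing the bound `η` in `F_i♭(w)(p)`. -/
def FibWitness (w : ιP → ℝ) (i : I) (p : ιP) (η : ℝ) (lam : ιP → ℝ)
    (σ : MvPoly d) (μ : Fin (S.nI i) → MvPoly d) (γ : Fin S.n0 → MvPoly d) : Prop :=
  (∀ q, 0 ≤ lam q) ∧ IsSOS σ ∧ (∀ l, IsSOS (μ l)) ∧ (∀ l, IsSOS (γ l)) ∧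
  (C η - aeval (S.T i) (S.tmpl p) - (∑ q, C (lam q) * (C (w q) - S.tmpl q))
      + (∑ l, μ l * S.rI i l) + (∑ l, γ l * S.r0 l) = σ) ∧
  σ.totalDegree ≤ 2 * m * degMap (S.T i) ∧
  ((∑ l, μ l * S.rI i l) + (∑ l, γ l * S.r0 l)).totalDegree ≤ 2 * m * degMap (S.T i)

/-- `F_i♭(w)(p)`. -/
def Fib (w : ιP → ℝ) (i : I) (p : ιP) : EReal :=
  sInf (Real.toEReal '' {η : ℝ | ∃ lam σ μ γ, S.FibWitness w i p η lam σ μ γ})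

/-- `X^in♭(p)`. -/
def Xinb (p : ιP) : EReal :=
  sInf (Real.toEReal '' {η : ℝ | ∃ (σ₀ : MvPoly d) (ν : Fin S.nin → MvPoly d),
    IsSOS σ₀ ∧ (∀ j, IsSOS (ν j)) ∧
    (C η - S.tmpl p + ∑ j, ν j * S.rin j = σ₀) ∧
    σ₀.totalDegree ≤ 2 * m ∧ (∑ j, ν j * S.rin j).totalDegree ≤ 2 * m})

/-- `F♭(w)(p)`. -/
def Fb (w : ιP → ℝ) (p : ιP) : EReal :=
  max (⨆ i, S.Fib w i p) (S.Xinb p)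

/-- `Sol(w,i,p)`: feasible tuples attaining the infimum `F_i♭(w)(p)`. -/
def Sol (w : ιP → ℝ) (i : I) (p : ιP) (lam : ιP → ℝ)
    (σ : MvPoly d) (μ : Fin (S.nI i) → MvPoly d) (γ : Fin S.n0 → MvPoly d) : Prop :=
  ∃ η : ℝ, S.FibWitness w i p η lam σ μ γ ∧ Real.toEReal η = S.Fib w i p

/-- `FS`: template bounds for which `Sol(w,i,p)` is nonempty for all `i`, `p`. -/
def FS (w : ιP → ℝ) : Prop :=
  ∀ (i : I) (p : ιP), ∃ lam σ μ γ, S.Sol w i p lam σ μ γ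

/-- `lamP` is the `λ`-part of a policy choice `π(w)`. -/
def IsPolicy (w : ιP → ℝ) (lamP : I → ιP → ιP → ℝ) : Prop :=
  ∀ (i : I) (p : ιP), ∃ σ μ γ, S.Sol w i p (lamP i p) σ μ γ

/-- `φ_{w,i,p}^λ(v)` for `v : P → ℝ̄`. -/
def phiE (w : ιP → ℝ) (lam : ιP → ℝ) (i : I) (p : ιP) (v : ιP → EReal) : EReal :=
  (∑ q, Real.toEReal (lam q) * v q) + S.Fib w i p - Real.toEReal (∑ q, lam q * w q)

/-- `Φ_w^{π(w)}(v)(p)`. -/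
def PhiE (w : ιP → ℝ) (lamP : I → ιP → ιP → ℝ) (v : ιP → EReal) (p : ιP) : EReal :=
  max (⨆ i, S.phiE w (lamP i p) i p v) (S.Xinb p)

/-- The least fixpoint of `Φ_w^{π(w)}` on the complete lattice `P → ℝ̄`
(by the Knaster–Tarski theorem, the infimum of the post-fixpoints). -/
def lfpPhi (w : ιP → ℝ) (lamP : I → ιP → ιP → ℝ) : ιP → EReal :=
  sInf {v : ιP → EReal | ∀ p, S.PhiE w lamP v p ≤ v p}

/-- The policy iteration sequence. -/
def IsPolicySeq (W : ℕ → ιP → EReal) : Prop :=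
  (∃ w0 : ιP → ℝ, RealRep (W 0) w0 ∧ ∀ p, S.Fb w0 p ≤ Real.toEReal (w0 p)) ∧
  (∀ p, ∃ r : ℝ, S.Xinb p = Real.toEReal r) ∧
  (∀ k : ℕ,
    (∀ wr : ιP → ℝ, RealRep (W k) wr → S.FS wr →
      ∃ lamP, S.IsPolicy wr lamP ∧ W (k + 1) = S.lfpPhi wr lamP) ∧
    ((¬ ∃ wr : ιP → ℝ, RealRep (W k) wr ∧ S.FS wr) → W (k + 1) = W k))

end PPSCtx

/-- A sum of squares of polynomials is nonnegative at every point. -/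
theorem IsSOS.eval_nonneg {d : ℕ} {q : MvPoly d} (hq : IsSOS q) (x : Fin d → ℝ) :
    0 ≤ eval x q := by
  obtain ⟨n, g, rfl⟩ := hq
  simp only [map_sum, map_pow]
  exact Finset.sum_nonneg fun j _ => sq_nonneg _

/-- A combination of constraints `r j ≤ 0` with sum-of-squares multipliers is nonpositive
wherever the constraints hold. -/
theorem eval_sum_isSOS_mul_nonpos {d n : ℕ} {s r : Fin n → MvPoly d} {x : Fin d → ℝ}
    (hs : ∀ j, IsSOS (s j)) (hr : ∀ j, eval x (r j) ≤ 0) :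
    eval x (∑ j, s j * r j) ≤ 0 := by
  simp only [map_sum, map_mul]
  exact Finset.sum_nonpos fun j _ =>
    mul_nonpos_of_nonneg_of_nonpos ((hs j).eval_nonneg x) (hr j)

theorem eval_aeval_eq_eval_polyMapApply {d : ℕ} (T : Fin d → MvPoly d) (q : MvPoly d)
    (x : Fin d → ℝ) : eval x (aeval T q) = eval (polyMapApply T x) q := by
  induction q using MvPolynomial.induction_on with
  | C a => simp
  | add p q hp hq => rw [map_add, map_add, map_add, hp, hq]
  | mul_X p j hp => rw [map_mul, map_mul, map_mul, hp, aeval_X, eval_X, polyMapApply]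

namespace PPSCtx

variable {d m : ℕ} {I ιP : Type} [Fintype I] [Fintype ιP] (S : PPSCtx d m I ιP)

theorem FsharpI_le_Fib (w : ιP → ℝ) (i : I) (p : ιP) : S.FsharpI w i p ≤ S.Fib w i p := by
  refine iSup₂_le fun x hx => le_sInf ?_
  rintro _ ⟨η, ⟨lam, σ, μ, γ, hlam, hσ, hμ, hγ, heq, -, -⟩, rfl⟩
  obtain ⟨⟨hxw, hxi⟩, hx0⟩ := hx
  have hlamx : 0 ≤ ∑ q, lam q * (w q - eval x (S.tmpl q)) :=
    Finset.sum_nonneg fun q _ => mul_nonneg (hlam q) (sub_nonneg.2 (hxw q))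
  have hμx := eval_sum_isSOS_mul_nonpos hμ hxi
  have hγx := eval_sum_isSOS_mul_nonpos hγ hx0
  have hσx := hσ.eval_nonneg x
  have h := congrArg (eval x) heq
  rw [map_add, map_add, map_sub, map_sub, eval_C, eval_aeval_eq_eval_polyMapApply,
    map_sum] at h
  simp only [map_mul (eval x) (C _), map_sub, eval_C] at h
  exact EReal.coe_le_coe_iff.2 (by linarith)

theorem XinDag_le_Xinb (p : ιP) : S.XinDag p ≤ S.Xinb p := by
  refine iSup₂_le fun x hx => le_sInf ?_
  rintro _ ⟨η, ⟨σ, ν, hσ, hν, heq, -, -⟩, rfl⟩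
  have hνx := eval_sum_isSOS_mul_nonpos hν hx
  have hσx := hσ.eval_nonneg x
  have h := congrArg (eval x) heq
  rw [map_add, map_sub, eval_C] at h
  exact EReal.coe_le_coe_iff.2 (by linarith)

end PPSCtx

/-- safety, part 3 of Prop. 2: `F♯(w)(p) ≤ F♭(w)(p)`. -/
theorem stmt6 {d m : ℕ} {I ιP : Type} [Fintype I] [Fintype ιP]
    (S : PPSCtx d m I ιP) (w : ιP → ℝ) (p : ιP) :
    max (⨆ i, S.FsharpI w i p) (S.XinDag p) ≤ S.Fb w p := by
  exact max_le_max (iSup_mono fun i => S.FsharpI_le_Fib w i p) (S.XinDag_le_Xinb p)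
end
end

section
/- Along the policy iteration sequence (w^k), for every k ∈ ℕ the iterate w^k is real-valued and satisfies F♭(w^k)(p) ≤ w^k(p) for all p ∈ P. -/
open MvPolynomial Filter

noncomputable section

namespace PPSCtx

variable {d m : ℕ} {I ιP : Type} [Fintype I] [Fintype ιP] (S : PPSCtx d m I ιP)

lemma phiE_mono (w : ιP → ℝ) {lam : ιP → ℝ} (hlam : ∀ q, 0 ≤ lam q) (i : I) (p : ιP) :
    Monotone (S.phiE w lam i p) := by
  intro v v' h
  refine EReal.sub_le_sub (add_le_add (Finset.sum_le_sum fun q _ => ?_) le_rfl) le_rfl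
  exact mul_le_mul_of_nonneg_left (h q) (EReal.coe_nonneg.mpr (hlam q))

lemma IsPolicy.nonneg {S : PPSCtx d m I ιP} {w : ιP → ℝ} {lamP : I → ιP → ιP → ℝ}
    (h : S.IsPolicy w lamP) (i : I) (p q : ιP) : 0 ≤ lamP i p q := by
  obtain ⟨_, _, _, _, hη, _⟩ := h i p
  exact hη.1 q

lemma PhiE_mono {w : ιP → ℝ} {lamP : I → ιP → ιP → ℝ} (h : S.IsPolicy w lamP) :
    Monotone (S.PhiE w lamP) := fun _ _ hv p =>
  max_le_max (iSup_mono fun i => S.phiE_mono w (h.nonneg i p) i p hv) le_rfl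

/-- On real arguments, `phiE` is an affine real function. -/
lemma phiE_coe {w : ιP → ℝ} {i : I} {p : ιP} {η : ℝ} (hη : Real.toEReal η = S.Fib w i p)
    (lam u : ιP → ℝ) :
    S.phiE w lam i p (fun q => Real.toEReal (u q)) =
      Real.toEReal (∑ q, lam q * u q + η - ∑ q, lam q * w q) := by
  have hsum : ∑ q, Real.toEReal (lam q) * Real.toEReal (u q) =
      Real.toEReal (∑ q, lam q * u q) := by
    simp only [← EReal.coe_mul]
    exact (map_sum (⟨⟨Real.toEReal, EReal.coe_zero⟩, EReal.coe_add⟩ : ℝ →+ EReal) _ _).symm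
  rw [phiE, ← hη, hsum, EReal.coe_sub, EReal.coe_add]

/-- The certificate for `w` is, after shifting the bound, a certificate for any other `u`. -/
lemma FibWitness.shift {S : PPSCtx d m I ιP} {w : ιP → ℝ} {i : I} {p : ιP} {η : ℝ}
    {lam : ιP → ℝ} {σ : MvPoly d} {μ : Fin (S.nI i) → MvPoly d} {γ : Fin S.n0 → MvPoly d}
    (h : S.FibWitness w i p η lam σ μ γ) (u : ιP → ℝ) :
    S.FibWitness u i p (∑ q, lam q * u q + η - ∑ q, lam q * w q) lam σ μ γ := by
  obtain ⟨hlam, hσ, hμ, hγ, heq, hdeg⟩ := h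
  refine ⟨hlam, hσ, hμ, hγ, ?_, hdeg⟩
  rw [← heq]
  simp only [map_sub, map_add, map_sum, map_mul, mul_sub, Finset.sum_sub_distrib]
  ring

lemma Fib_le_phiE {w : ιP → ℝ} {lamP : I → ιP → ιP → ℝ} (h : S.IsPolicy w lamP)
    (u : ιP → ℝ) (i : I) (p : ιP) :
    S.Fib u i p ≤ S.phiE w (lamP i p) i p fun q => Real.toEReal (u q) := by
  obtain ⟨σ, μ, γ, η, hwit, hη⟩ := h i p
  rw [S.phiE_coe hη]
  exact sInf_le ⟨_, ⟨_, _, _, _, hwit.shift u⟩, rfl⟩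

lemma Fb_le_PhiE {w : ιP → ℝ} {lamP : I → ιP → ιP → ℝ} (h : S.IsPolicy w lamP)
    (u : ιP → ℝ) (p : ιP) :
    S.Fb u p ≤ S.PhiE w lamP (fun q => Real.toEReal (u q)) p :=
  max_le_max (iSup_mono fun i => S.Fib_le_phiE h u i p) le_rfl

lemma PhiE_self {w : ιP → ℝ} {lamP : I → ιP → ιP → ℝ} (h : S.IsPolicy w lamP) (p : ιP) :
    S.PhiE w lamP (fun q => Real.toEReal (w q)) p = S.Fb w p := by
  have hi (i : I) :
      S.phiE w (lamP i p) i p (fun q => Real.toEReal (w q)) = S.Fib w i p := by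
    obtain ⟨_, _, _, _, _, hη⟩ := h i p
    rw [S.phiE_coe hη, add_sub_cancel_left, hη]
  simp only [PhiE, Fb, hi]

lemma PhiE_lfpPhi_le {w : ιP → ℝ} {lamP : I → ιP → ιP → ℝ} (h : S.IsPolicy w lamP) :
    S.PhiE w lamP (S.lfpPhi w lamP) ≤ S.lfpPhi w lamP :=
  le_sInf fun _ hv => (S.PhiE_mono h (sInf_le hv)).trans hv

/-- A policy improvement step preserves being a real-valued post-fixpoint of `F♭`. -/
lemma exists_realRep_lfpPhi {w : ιP → ℝ} {lamP : I → ιP → ιP → ℝ} (h : S.IsPolicy w lamP)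
    (hX : ∀ p, ∃ r : ℝ, S.Xinb p = Real.toEReal r)
    (hw : ∀ p, S.Fb w p ≤ Real.toEReal (w p)) :
    ∃ u : ιP → ℝ, RealRep (S.lfpPhi w lamP) u ∧ ∀ p, S.Fb u p ≤ Real.toEReal (u p) := by
  have hle : S.lfpPhi w lamP ≤ fun q => Real.toEReal (w q) :=
    sInf_le fun p => (S.PhiE_self h p).trans_le (hw p)
  have hpost := S.PhiE_lfpPhi_le h
  have hrep : RealRep (S.lfpPhi w lamP) fun p => (S.lfpPhi w lamP p).toReal := by
    intro p
    obtain ⟨r, hr⟩ := hX p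
    have hge : Real.toEReal r ≤ S.lfpPhi w lamP p :=
      hr ▸ (le_max_right _ _).trans (hpost p)
    exact EReal.coe_toReal ((hle p).trans_lt (EReal.coe_lt_top _)).ne
      ((EReal.bot_lt_coe r).trans_le hge).ne'
  refine ⟨_, hrep, fun p => (S.Fb_le_PhiE h _ p).trans ?_⟩
  rw [funext hrep, hrep p]
  exact hpost p

end PPSCtx

/-- part 1 of Theorem 1: every iterate `w^k` of the policy iteration
sequence is real-valued and satisfies `F♭(w^k) ≤ w^k`. -/
theorem stmt15 {d m : ℕ} {I ιP : Type} [Fintype I] [Fintype ιP]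
    (S : PPSCtx d m I ιP) (W : ℕ → ιP → EReal) (hseq : S.IsPolicySeq W) (k : ℕ) :
    ∃ wr : ιP → ℝ, RealRep (W k) wr ∧ ∀ p, S.Fb wr p ≤ Real.toEReal (wr p) := by
  obtain ⟨h0, hX, hstep⟩ := hseq
  induction k with
  | zero => exact h0
  | succ k ih =>
    by_cases hFS : ∃ wr : ιP → ℝ, RealRep (W k) wr ∧ S.FS wr
    · obtain ⟨wr, hrep, hFS⟩ := hFS
      obtain ⟨w, hw, hFb⟩ := ih
      obtain rfl : w = wr :=
        funext fun p => EReal.coe_injective ((hw p).trans (hrep p).symm)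
      obtain ⟨lamP, hpol, hW⟩ := (hstep k).1 w hrep hFS
      rw [hW]
      exact S.exists_realRep_lfpPhi hpol hX hFb
    · rw [(hstep k).2 hFS]
      exact ih
end
end
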